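/- Let s = (x,y) ∈ ℝ² with s ≠ 0, let π ∈ ℝ² with π ≠ 0, and let λ_w ∈ ℝ. Define λ_s = λ_w ‖s‖ (J_w̄(s) S(s))⁻¹ π/‖π‖ and w = (S(s) λ_s/‖s‖, 0) ∈ ℝ³. Then: (a) J_w(s) w = λ_w π/‖π‖; (b) J_l(s) w = λ_w (sᵀπ) / ((1+x²+y²)‖π‖), so J_l(s) w ≤ 0 whenever λ_w sᵀπ ≤ 0; and (c) ‖w‖ ≤ |λ_w|, so ‖w‖ ≤ w_max whenever |λ_w| ≤ w_max. -/

import Mathlib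

open Matrix

/-- The point `s = (x,y)` as a vector of `ℝ²` with the Euclidean norm. -/
noncomputable def e2 (a b : ℝ) : EuclideanSpace ℝ (Fin 2) :=
  (WithLp.equiv 2 (Fin 2 → ℝ)).symm ![a, b]

/-- A vector of `ℝ³` with the Euclidean norm. -/
noncomputable def e3 (a b c : ℝ) : EuclideanSpace ℝ (Fin 3) :=
  (WithLp.equiv 2 (Fin 3 → ℝ)).symm ![a, b, c]

/-- The matrix `J_w̄(x,y) = [[xy, −(1+x²)],[1+y², −xy]]`. -/
def Jwbar (x y : ℝ) : Matrix (Fin 2) (Fin 2) ℝ :=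
  !![x * y, -(1 + x ^ 2); 1 + y ^ 2, -(x * y)]

/-- The matrix `J_w(s) = [[xy, −(1+x²), y],[1+y², −xy, −x]]`. -/
def Jw (x y : ℝ) : Matrix (Fin 2) (Fin 3) ℝ :=
  !![x * y, -(1 + x ^ 2), y; 1 + y ^ 2, -(x * y), -x]

/-- The matrix `S(s)` whose columns are `−s_⊥/‖s_⊥‖` and `s/‖s‖`, where
`s = (x,y)` and `s_⊥ = (−y, x)`. -/
noncomputable def Smat (x y : ℝ) : Matrix (Fin 2) (Fin 2) ℝ :=
  !![y / ‖e2 (-y) x‖, x / ‖e2 x y‖; -x / ‖e2 (-y) x‖, y / ‖e2 x y‖]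

/-- `J_l(s) w` for `s = (x,y)` and `J_l(s) = [y,−x,0]`. -/
def Jl (x y : ℝ) (w : Fin 3 → ℝ) : ℝ := y * w 0 - x * w 1

theorem norm_sq_e2 (a b : ℝ) : ‖e2 a b‖ ^ 2 = a ^ 2 + b ^ 2 := by
  simp [EuclideanSpace.norm_sq_eq, e2]

theorem norm_sq_e3 (a b c : ℝ) : ‖e3 a b c‖ ^ 2 = a ^ 2 + b ^ 2 + c ^ 2 := by
  simp [EuclideanSpace.norm_sq_eq, e3, Fin.sum_univ_three]

theorem norm_e2_pos {a b : ℝ} (h : ¬(a = 0 ∧ b = 0)) : 0 < ‖e2 a b‖ := by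
  refine (norm_nonneg _).lt_of_ne' fun h0 => h ?_
  have h1 := norm_sq_e2 a b
  rw [h0] at h1
  constructor <;> nlinarith [sq_nonneg a, sq_nonneg b]

theorem norm_e2_rotate (a b : ℝ) : ‖e2 (-b) a‖ = ‖e2 a b‖ := by
  rw [← sq_eq_sq₀ (norm_nonneg _) (norm_nonneg _), norm_sq_e2, norm_sq_e2]
  ring

theorem Smat_det {x y : ℝ} (hs : ¬(x = 0 ∧ y = 0)) : (Smat x y).det = 1 := by
  have hn := norm_e2_pos hs
  have h2 := norm_sq_e2 x y
  rw [Smat, norm_e2_rotate, det_fin_two_of]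
  field_simp
  linarith

theorem Jwbar_det (x y : ℝ) : (Jwbar x y).det = 1 + x ^ 2 + y ^ 2 := by
  rw [Jwbar, det_fin_two_of]
  ring

theorem Smat_mul_inv_Jwbar_mul_Smat {x y : ℝ} (hs : ¬(x = 0 ∧ y = 0)) :
    Smat x y * (Jwbar x y * Smat x y)⁻¹ = (1 + x ^ 2 + y ^ 2)⁻¹ •
      !![-(x * y), 1 + x ^ 2; -(1 + y ^ 2), x * y] := by
  have hS : IsUnit (Smat x y).det := by simp [Smat_det hs]
  rw [Matrix.mul_inv_rev, ← Matrix.mul_assoc, Matrix.mul_nonsing_inv _ hS, Matrix.one_mul,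
    Matrix.inv_def, Jwbar_det, Ring.inverse_eq_inv', Jwbar, adjugate_fin_two_of, neg_neg]

/-- For `s ≠ 0`, `π ≠ 0`, `λ_s = λ_w ‖s‖ (J_w̄ S)⁻¹ π/‖π‖` and `w = (S λ_s/‖s‖, 0)`:
(a) `J_w(s) w = λ_w π/‖π‖`; (b) `J_l(s) w = λ_w sᵀπ/((1+x²+y²)‖π‖)`, which is `≤ 0`
whenever `λ_w sᵀπ ≤ 0`; and (c) `‖w‖ ≤ |λ_w|`, so `‖w‖ ≤ w_max` whenever
`|λ_w| ≤ w_max`. -/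
theorem suboptimal_angular_velocity (x y p1 p2 lw wmax : ℝ)
    (hs : ¬(x = 0 ∧ y = 0)) (hp : ¬(p1 = 0 ∧ p2 = 0)) (hwmax : 0 < wmax) :
    ∀ ls u : Fin 2 → ℝ,
      ls = (lw * ‖e2 x y‖ / ‖e2 p1 p2‖) •
          ((Jwbar x y * Smat x y)⁻¹.mulVec ![p1, p2]) →
      u = (Smat x y).mulVec ls →
      -- (a) tracking direction
      (Jw x y).mulVec ![u 0 / ‖e2 x y‖, u 1 / ‖e2 x y‖, 0] =
        (lw / ‖e2 p1 p2‖) • ![p1, p2] ∧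
      -- (b) the sign of J_l(s) w
      Jl x y ![u 0 / ‖e2 x y‖, u 1 / ‖e2 x y‖, 0] =
        lw * (x * p1 + y * p2) / ((1 + x ^ 2 + y ^ 2) * ‖e2 p1 p2‖) ∧
      (lw * (x * p1 + y * p2) ≤ 0 →
        Jl x y ![u 0 / ‖e2 x y‖, u 1 / ‖e2 x y‖, 0] ≤ 0) ∧
      -- (c) the kinodynamic bound
      ‖e3 (u 0 / ‖e2 x y‖) (u 1 / ‖e2 x y‖) 0‖ ≤ |lw| ∧
      (|lw| ≤ wmax → ‖e3 (u 0 / ‖e2 x y‖) (u 1 / ‖e2 x y‖) 0‖ ≤ wmax) := by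
  rintro ls u rfl rfl
  have hn := norm_e2_pos hs
  have hq := norm_e2_pos hp
  have hq2 := norm_sq_e2 p1 p2
  have hD : 0 < 1 + x ^ 2 + y ^ 2 := by positivity
  rw [Matrix.mulVec_smul, Matrix.mulVec_mulVec, Smat_mul_inv_Jwbar_mul_Smat hs]
  set n := ‖e2 x y‖
  set q := ‖e2 p1 p2‖
  set D := 1 + x ^ 2 + y ^ 2 with hDdef
  set u := (lw * n / q) • (D⁻¹ • !![-(x * y), 1 + x ^ 2; -(1 + y ^ 2), x * y]).mulVec ![p1, p2]
    with hu
  have h0 : u 0 / n = lw / (D * q) * (-(x * y) * p1 + (1 + x ^ 2) * p2) := by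
    simp [hu]
    field_simp
  have h1 : u 1 / n = lw / (D * q) * (-(1 + y ^ 2) * p1 + x * y * p2) := by
    simp [hu]
    field_simp
  rw [h0, h1]
  have hb : Jl x y ![lw / (D * q) * (-(x * y) * p1 + (1 + x ^ 2) * p2),
      lw / (D * q) * (-(1 + y ^ 2) * p1 + x * y * p2), 0] =
      lw * (x * p1 + y * p2) / (D * q) := by
    simp only [Jl, cons_val_zero, cons_val_one]
    ring
  have hc : ‖e3 (lw / (D * q) * (-(x * y) * p1 + (1 + x ^ 2) * p2))
      (lw / (D * q) * (-(1 + y ^ 2) * p1 + x * y * p2)) 0‖ ≤ |lw| := by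
    refine (abs_le_of_sq_le_sq' ?_ (abs_nonneg _)).2
    have key : (-(x * y) * p1 + (1 + x ^ 2) * p2) ^ 2 + (-(1 + y ^ 2) * p1 + x * y * p2) ^ 2
        ≤ (D * q) ^ 2 := by
      have hnn : 0 ≤ (D + 1) * (x * p1 + y * p2) ^ 2 := by positivity
      rw [mul_pow, hq2]
      linear_combination hnn
    rw [norm_sq_e3, sq_abs]
    calc _ = lw ^ 2 * (((-(x * y) * p1 + (1 + x ^ 2) * p2) ^ 2
          + (-(1 + y ^ 2) * p1 + x * y * p2) ^ 2) / (D * q) ^ 2) := by field_simp; ring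
      _ ≤ lw ^ 2 * 1 := by
        gcongr
        exact div_le_one_of_le₀ key (sq_nonneg _)
      _ = lw ^ 2 := mul_one _
  refine ⟨?_, hb, fun h => ?_, hc, hc.trans⟩
  · ext i
    fin_cases i <;> simp [Jw, Matrix.mulVec, dotProduct, Fin.sum_univ_three] <;> field_simp <;>
      rw [hDdef] <;> ring
  · rw [hb]
    exact div_nonpos_of_nonpos_of_nonneg h (by positivity)
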